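/- arXiv:2503.02178 — 2 statements merged into one kernel-verified Lean document; each statement's English description precedes it below -/
import Mathlib

section
/- Suppose 0 < F(x_k) < 1 for every k ∈ ℤ. Define n-step transition probabilities P^n : ℤ × ℤ → [0,1] by P^1(s,t) = F_s if t = s + p − q, P^1(s,t) = 1 − F_s if t = s + p, P^1(s,t) = 0 otherwise, and P^{n+1}(s,t) = Σ_{l∈ℤ} P^n(s,l) P^1(l,t). Then (irreducibility) for all s, t ∈ ℤ there exists n ≥ 1 with P^n(s,t) > 0, and (period q) for all s ∈ ℤ and n ≥ 1, P^n(s,s) > 0 implies q divides n. -/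
open Filter Topology

/-- Summing against a kernel that jumps by `p - q` with weight `a` and by `p` with weight `b`. -/
theorem tsum_mul_two_jump_kernel {p q : ℤ} (hq : q ≠ 0) (a b f : ℤ → ℝ) (t : ℤ) :
    ∑' l : ℤ, f l * (if t = l + p - q then a l else if t = l + p then b l else 0) =
      f (t - p + q) * a (t - p + q) + f (t - p) * b (t - p) := by
  rw [tsum_eq_sum (s := {t - p + q, t - p}), Finset.sum_pair (by omega)]
  · rw [if_pos (by ring), if_neg (by omega), if_pos (by ring)]
  · intro l hl
    simp only [Finset.mem_insert, Finset.mem_singleton, not_or] at hl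
    rw [if_neg (by omega), if_neg (by omega), mul_zero]

/-- The `n`-step transition weights of a chain on `ℤ` that jumps by `p - q` or by `p` with positive
weights are nonnegative, and positive exactly at the endpoints of the paths with `n` jumps. -/
theorem two_jump_chain_nonneg_and_pos_iff {p q : ℤ} (hq : q ≠ 0) {a b : ℤ → ℝ}
    (ha : ∀ k, 0 < a k) (hb : ∀ k, 0 < b k) {P : ℕ → ℤ → ℤ → ℝ}
    (hP1 : ∀ s t, P 1 s t = if t = s + p - q then a s else if t = s + p then b s else 0)
    (hPrec : ∀ n : ℕ, 1 ≤ n → ∀ s t : ℤ, P (n + 1) s t = ∑' l : ℤ, P n s l * P 1 l t)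
    {n : ℕ} (hn : 1 ≤ n) (s t : ℤ) :
    0 ≤ P n s t ∧ (0 < P n s t ↔ ∃ j : ℕ, j ≤ n ∧ t = s + n * p - j * q) := by
  induction n, hn using Nat.le_induction generalizing t with
  | base =>
    rw [hP1]
    split_ifs with h₁ h₂
    · exact ⟨(ha s).le, iff_of_true (ha s) ⟨1, le_rfl, by push_cast; linarith⟩⟩
    · exact ⟨(hb s).le, iff_of_true (hb s) ⟨0, by omega, by push_cast; linarith⟩⟩
    · refine ⟨le_rfl, iff_of_false (lt_irrefl 0) ?_⟩
      rintro ⟨j, hj, rfl⟩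
      interval_cases j
      · exact h₂ (by push_cast; ring)
      · exact h₁ (by push_cast; ring)
  | succ n hn ih =>
    have hrec : P (n + 1) s t =
        P n s (t - p + q) * a (t - p + q) + P n s (t - p) * b (t - p) := by
      rw [hPrec n hn]
      simp only [hP1]
      exact tsum_mul_two_jump_kernel hq a b (P n s) t
    have h₁ := mul_nonneg (ih (t - p + q)).1 (ha (t - p + q)).le
    have h₂ := mul_nonneg (ih (t - p)).1 (hb (t - p)).le
    rw [hrec]
    refine ⟨add_nonneg h₁ h₂, fun h => ?_, ?_⟩
    · rcases (by by_contra! hc; linarith :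
        0 < P n s (t - p + q) * a (t - p + q) ∨ 0 < P n s (t - p) * b (t - p)) with h | h
      · obtain ⟨j, hj, e⟩ := (ih _).2.1 (pos_of_mul_pos_left h (ha _).le)
        exact ⟨j + 1, by omega, by push_cast; linarith⟩
      · obtain ⟨j, hj, e⟩ := (ih _).2.1 (pos_of_mul_pos_left h (hb _).le)
        exact ⟨j, by omega, by push_cast; linarith⟩
    · rintro ⟨j, hj, e⟩
      push_cast at e
      rcases hj.lt_or_eq with hlt | rfl
      · exact add_pos_of_nonneg_of_pos h₁
          (mul_pos ((ih _).2.2 ⟨j, by omega, by linarith⟩) (hb _))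
      · push_cast at e
        exact add_pos_of_pos_of_nonneg
          (mul_pos ((ih _).2.2 ⟨n, le_rfl, by linarith⟩) (ha _)) h₂

/-- For coprime `0 < p < q`, every integer is `n * p - j * q` with `0 ≤ j ≤ n` and `1 ≤ n`. -/
theorem exists_nat_mul_sub_mul_eq {p q : ℕ} (hcop : Nat.Coprime p q) (hp : 0 < p) (hpq : p < q)
    (d : ℤ) : ∃ n j : ℕ, 1 ≤ n ∧ j ≤ n ∧ (n : ℤ) * p - j * q = d := by
  obtain ⟨u, v, huv⟩ := Int.isCoprime_iff_gcd_eq_one.2 (by simpa using hcop : Int.gcd p q = 1)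
  set k : ℤ := |u * d| + |v * d| + 1 with hk
  have hu := neg_abs_le (u * d)
  have hv := neg_abs_le (v * d)
  have hu₀ := abs_nonneg (u * d)
  have hv₀ := abs_nonneg (v * d)
  have hkp : k ≤ k * p := le_mul_of_one_le_right (by omega) (by omega)
  have hkqp : k ≤ k * (q - p) := le_mul_of_one_le_right (by omega) (by omega)
  have hkq : k * (q - p) = k * q - k * p := by ring
  obtain ⟨n, hn⟩ := Int.eq_ofNat_of_zero_le (by linarith : 0 ≤ u * d + k * q)
  obtain ⟨j, hj⟩ := Int.eq_ofNat_of_zero_le (by linarith [le_abs_self (v * d)] :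
    0 ≤ -(v * d) + k * p)
  refine ⟨n, j, by zify; linarith, by zify; linarith, ?_⟩
  rw [← hn, ← hj]
  linear_combination d * huv

/-- The quantile-SGD Markov chain is irreducible and has period `q`. -/
theorem quantile_sgd_irreducible_period
    (p q : ℕ) (hcop : Nat.Coprime p q) (hp : 0 < p) (hpq : p < q)
    (η : ℝ) (hη : 0 < η) (F : ℝ → ℝ) (x₀ : ℝ)
    (hF01 : ∀ k : ℤ, 0 < F (x₀ + (k : ℝ) * η / (q : ℝ)) ∧ F (x₀ + (k : ℝ) * η / (q : ℝ)) < 1)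
    (P : ℕ → ℤ → ℤ → ℝ)
    (hP1 : ∀ s t : ℤ, P 1 s t =
      if t = s + (p : ℤ) - (q : ℤ) then F (x₀ + (s : ℝ) * η / (q : ℝ))
      else if t = s + (p : ℤ) then 1 - F (x₀ + (s : ℝ) * η / (q : ℝ))
      else 0)
    (hPrec : ∀ n : ℕ, 1 ≤ n → ∀ s t : ℤ,
      P (n + 1) s t = ∑' l : ℤ, P n s l * P 1 l t) :
    (∀ s t : ℤ, ∃ n : ℕ, 1 ≤ n ∧ 0 < P n s t) ∧
      (∀ s : ℤ, ∀ n : ℕ, 1 ≤ n → 0 < P n s s → q ∣ n) := by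
  have hq : (q : ℤ) ≠ 0 := by omega
  have key {n : ℕ} (hn : 1 ≤ n) (s t : ℤ) :=
    (two_jump_chain_nonneg_and_pos_iff hq (fun k => (hF01 k).1)
      (fun k => sub_pos.2 (hF01 k).2) hP1 hPrec hn s t).2
  refine ⟨fun s t => ?_, fun s n hn h => ?_⟩
  · obtain ⟨n, j, hn, hj, e⟩ := exists_nat_mul_sub_mul_eq hcop hp hpq (t - s)
    exact ⟨n, hn, (key hn s t).2 ⟨j, hj, by linarith⟩⟩
  · obtain ⟨j, -, e⟩ := (key hn s s).1 h
    have hnp : n * p = j * q := by zify; linarith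
    exact hcop.symm.dvd_of_dvd_mul_right (hnp ▸ dvd_mul_left q j)
end

section
/- Let Assumption 1 hold and suppose |x₀ − θ(τ)| ≤ η. Define standardized states x̃_k = k√η/q, the functions f̃(x) = x² e^{|x|} and g̃(x) = x² e^{2|x|}, and k_η = ⌈ q log(1/η) / √η ⌉. Then there exists η₀ > 0 such that for all 0 < η < η₀ and all k ∈ ℤ with |k| ≥ k_η, the one-step expected value of g̃ from state k satisfies F_k · g̃(x̃_{k+p−q}) + (1 − F_k) · g̃(x̃_{k+p}) ≤ g̃(x̃_k) − f̃(x̃_k). -/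
open Filter Topology

/-- The function `f̃(x) = x² e^{|x|}`. -/
noncomputable def ftil (x : ℝ) : ℝ := x ^ 2 * Real.exp |x|

/-- The function `g̃(x) = x² e^{2|x|}`. -/
noncomputable def gtil (x : ℝ) : ℝ := x ^ 2 * Real.exp (2 * |x|)

theorem gtil_neg (x : ℝ) : gtil (-x) = gtil x := by
  simp [gtil]

theorem ftil_neg (x : ℝ) : ftil (-x) = ftil x := by
  simp [ftil]

/-- Second-order upper bound for `gtil` at a small displacement from a point `x ≥ 1`. -/
theorem gtil_add_le {x a : ℝ} (hx : 1 ≤ x) (ha : |a| ≤ 1 / 2) :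
    gtil (x + a) ≤
      Real.exp (2 * x) * (x ^ 2 + (2 * x + 2 * x ^ 2) * a + 15 * x ^ 2 * a ^ 2) := by
  obtain ⟨hal, hau⟩ := abs_le.mp ha
  have hexp : Real.exp (2 * a) ≤ 1 + 2 * a + 4 * a ^ 2 := by
    have h := (abs_le.mp (Real.abs_exp_sub_one_sub_id_le (x := 2 * a)
      (abs_le.mpr ⟨by linarith, by linarith⟩))).2
    linarith
  have hpoly : (x + a) ^ 2 * (1 + 2 * a + 4 * a ^ 2) ≤
      x ^ 2 + (2 * x + 2 * x ^ 2) * a + 15 * x ^ 2 * a ^ 2 := by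
    have hxa : x * a ≤ x * (1 / 2) := mul_le_mul_of_nonneg_left hau (by linarith)
    have hcoef : 0 ≤ 15 * x ^ 2 - (1 + 4 * x + 2 * a + 4 * x ^ 2 + 8 * (x * a) + 4 * a ^ 2) := by
      nlinarith
    nlinarith [mul_nonneg (sq_nonneg a) hcoef]
  have habs : |x + a| = x + a := abs_of_nonneg (by linarith)
  calc gtil (x + a) = Real.exp (2 * x) * ((x + a) ^ 2 * Real.exp (2 * a)) := by
        rw [gtil, habs, mul_add, Real.exp_add]; ring
    _ ≤ Real.exp (2 * x) * ((x + a) ^ 2 * (1 + 2 * a + 4 * a ^ 2)) := by gcongr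
    _ ≤ _ := by gcongr

/-- One-step drift of `gtil` from `x`, for a walk of step size `h` moving towards the origin with
probability `P`, when `P` exceeds its balanced value `t` by at least `8 * h`. -/
theorem gtil_drift_of_bias {x h t P : ℝ} (hx : 1 ≤ x) (h0 : 0 < h) (h1 : h ≤ 1 / 2)
    (ht0 : 0 ≤ t) (ht1 : t ≤ 1) (hP0 : 0 ≤ P) (hP1 : P ≤ 1) (hbias : 8 * h ≤ P - t)
    (hexp : Real.exp (-x) ≤ h ^ 2) :
    P * gtil (x - (1 - t) * h) + (1 - P) * gtil (x + t * h) ≤ gtil x - ftil x := by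
  have hdown := gtil_add_le (a := -((1 - t) * h)) hx
    (abs_le.mpr ⟨by nlinarith, by nlinarith⟩)
  have hup := gtil_add_le (a := t * h) hx (abs_le.mpr ⟨by nlinarith, by nlinarith⟩)
  rw [← sub_eq_add_neg] at hdown
  have hvar : P * (1 - t) ^ 2 + (1 - P) * t ^ 2 ≤ 1 := by
    have hsq : (1 - t) ^ 2 ≤ 1 := by nlinarith
    have hsq' : t ^ 2 ≤ 1 := by nlinarith
    nlinarith
  have hlin : 0 ≤ x * ((P - t) * h) :=
    mul_nonneg (by linarith) (mul_nonneg (by linarith) h0.le)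
  have hbias' : 0 ≤ x ^ 2 * h * (P - t - 8 * h) :=
    mul_nonneg (by positivity) (by linarith)
  have hvar' : 0 ≤ x ^ 2 * h ^ 2 * (1 - (P * (1 - t) ^ 2 + (1 - P) * t ^ 2)) :=
    mul_nonneg (by positivity) (by linarith)
  have hf : ftil x = Real.exp (2 * x) * (x ^ 2 * Real.exp (-x)) := by
    rw [ftil, abs_of_nonneg (by linarith), mul_left_comm, ← Real.exp_add]
    congr 2; ring
  have hg : gtil x = Real.exp (2 * x) * x ^ 2 := by
    rw [gtil, abs_of_nonneg (by linarith), mul_comm]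
  calc P * gtil (x - (1 - t) * h) + (1 - P) * gtil (x + t * h)
      ≤ P * (Real.exp (2 * x) * (x ^ 2 + (2 * x + 2 * x ^ 2) * -((1 - t) * h)
            + 15 * x ^ 2 * (-((1 - t) * h)) ^ 2))
          + (1 - P) * (Real.exp (2 * x) * (x ^ 2 + (2 * x + 2 * x ^ 2) * (t * h)
            + 15 * x ^ 2 * (t * h) ^ 2)) :=
        add_le_add (mul_le_mul_of_nonneg_left hdown hP0)
          (mul_le_mul_of_nonneg_left hup (by linarith))
    _ = Real.exp (2 * x) * (x ^ 2 - (2 * x + 2 * x ^ 2) * ((P - t) * h)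
          + 15 * (x ^ 2 * h ^ 2 * (P * (1 - t) ^ 2 + (1 - P) * t ^ 2))) := by ring
    _ ≤ Real.exp (2 * x) * (x ^ 2 - x ^ 2 * h ^ 2) := by
        gcongr
        linarith
    _ ≤ Real.exp (2 * x) * (x ^ 2 - x ^ 2 * Real.exp (-x)) := by gcongr
    _ = gtil x - ftil x := by rw [hf, hg]; ring

/-- Near a point of positive derivative, a function grows at least at half the rate
of its derivative. -/
theorem HasDerivAt.exists_half_slope_bound {F : ℝ → ℝ} {θ m : ℝ} (h : HasDerivAt F m θ)
    (hm : 0 < m) :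
    ∃ ε > 0, ∀ s, 0 ≤ s → s < ε →
      F θ + m / 2 * s ≤ F (θ + s) ∧ F (θ - s) ≤ F θ - m / 2 * s := by
  obtain ⟨ε, hε, hball⟩ := Metric.eventually_nhds_iff.mp
    ((hasDerivAt_iff_isLittleO.mp h).bound (half_pos hm))
  refine ⟨ε, hε, fun s hs hsε => ⟨?_, ?_⟩⟩
  · have hb := hball (y := θ + s) (by simpa [Real.dist_eq, abs_of_nonneg hs] using hsε)
    simp only [add_sub_cancel_left, smul_eq_mul, Real.norm_eq_abs, abs_of_nonneg hs] at hb
    linarith [(abs_le.mp hb).1]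
  · have hb := hball (y := θ - s) (by simpa [Real.dist_eq, abs_of_nonneg hs] using hsε)
    simp only [sub_sub_cancel_left, smul_eq_mul, Real.norm_eq_abs, abs_neg,
      abs_of_nonneg hs] at hb
    linarith [(abs_le.mp hb).2]

/-- Drift inequality for the quantile-SGD chain: for all sufficiently small `η` and all
states `|k| ≥ k_η = ⌈q log(1/η)/√η⌉`, the one-step expectation of `g̃` satisfies
`F_k g̃(x̃_{k+p−q}) + (1 − F_k) g̃(x̃_{k+p}) ≤ g̃(x̃_k) − f̃(x̃_k)`. -/
theorem quantile_sgd_drift_inequality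
    (p q : ℕ) (hcop : Nat.Coprime p q) (hp : 0 < p) (hpq : p < q)
    (F f : ℝ → ℝ) (θ r : ℝ)
    (hmono : Monotone F)
    (hbot : Tendsto F atBot (𝓝 0)) (htop : Tendsto F atTop (𝓝 1))
    (hθ : F θ = (p : ℝ) / (q : ℝ)) (hr : 0 < r)
    (hderiv : ∀ x ∈ Set.Icc (θ - r) (θ + r), HasDerivAt F (f x) x)
    (hC2 : ContDiffOn ℝ 2 f (Set.Icc (θ - r) (θ + r)))
    (hfθ : 0 < f θ)
    (x₀ : ℝ → ℝ) (hx₀ : ∀ η : ℝ, 0 < η → |x₀ η - θ| ≤ η) :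
    ∃ η₀ > (0 : ℝ), ∀ η : ℝ, 0 < η → η < η₀ → ∀ k : ℤ,
      ⌈(q : ℝ) * Real.log (1 / η) / Real.sqrt η⌉ ≤ |k| →
      F (x₀ η + (k : ℝ) * η / (q : ℝ))
          * gtil (((k : ℝ) + (p : ℝ) - (q : ℝ)) * Real.sqrt η / (q : ℝ))
        + (1 - F (x₀ η + (k : ℝ) * η / (q : ℝ)))
            * gtil (((k : ℝ) + (p : ℝ)) * Real.sqrt η / (q : ℝ))
        ≤ gtil ((k : ℝ) * Real.sqrt η / (q : ℝ)) - ftil ((k : ℝ) * Real.sqrt η / (q : ℝ)) := by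
  have hF0 : ∀ y, 0 ≤ F y := hmono.le_of_tendsto hbot
  have hF1 : ∀ y, F y ≤ 1 := hmono.ge_of_tendsto htop
  have hq : (0 : ℝ) < q := by exact_mod_cast hp.trans hpq
  have hτ0 : (0 : ℝ) ≤ p / q := by positivity
  have hτ1 : (p : ℝ) / q ≤ 1 := by
    rw [div_le_one hq]; exact_mod_cast hpq.le
  obtain ⟨ε, hε, hslope⟩ :=
    (hderiv θ ⟨by linarith, by linarith⟩).exists_half_slope_bound hfθ
  have hsmall : ∀ᶠ η in 𝓝[>] (0 : ℝ),
      √η ≤ 1 / 2 ∧ 16 / f θ * √η < ε ∧ 16 / f θ + 1 ≤ Real.log (1 / η) := by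
    have hsqrt : Tendsto (fun η : ℝ => √η) (𝓝[>] 0) (𝓝 0) := by
      simpa using (Real.continuous_sqrt.tendsto 0).mono_left nhdsWithin_le_nhds
    have hmul : Tendsto (fun η : ℝ => 16 / f θ * √η) (𝓝[>] 0) (𝓝 0) := by
      simpa using hsqrt.const_mul (16 / f θ)
    have hlog : Tendsto (fun η : ℝ => Real.log (1 / η)) (𝓝[>] 0) atTop := by
      simp only [one_div]
      exact Real.tendsto_log_atTop.comp tendsto_inv_nhdsGT_zero
    exact (hsqrt.eventually_le_const (by norm_num)).and
      ((hmul.eventually_lt_const hε).and (hlog.eventually_ge_atTop _))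
  obtain ⟨η₀, hη₀, hgood⟩ := mem_nhdsGT_iff_exists_Ioo_subset.mp hsmall
  refine ⟨η₀, hη₀, fun η hη hηlt k hk => ?_⟩
  obtain ⟨hh1, hhε, hL⟩ := hgood ⟨hη, hηlt⟩
  have hx₀η := abs_le.mp (hx₀ η hη)
  set h := √η with hh
  have h0 : 0 < h := Real.sqrt_pos.mpr hη
  have hη2 : η = h ^ 2 := (Real.sq_sqrt hη.le).symm
  have hs0 : 0 ≤ 16 / f θ * h := by positivity
  obtain ⟨hright, hleft⟩ := hslope _ hs0 hhε
  have hbias : f θ / 2 * (16 / f θ * h) = 8 * h := by field_simp; norm_num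
  rw [hbias, hθ] at hright hleft
  set x := (k : ℝ) * h / q with hx
  have hLx : Real.log (1 / η) ≤ |x| := by
    have hk' : (q : ℝ) * Real.log (1 / η) / h ≤ |(k : ℝ)| := by
      exact_mod_cast Int.ceil_le.mp hk
    rw [hx, abs_div, abs_mul, abs_of_pos h0, abs_of_pos hq, le_div_iff₀ hq]
    rw [div_le_iff₀ h0] at hk'
    linarith
  have hx1 : 1 ≤ |x| := by
    have : 0 < 16 / f θ := by positivity
    linarith
  have hexp : Real.exp (-|x|) ≤ h ^ 2 := by
    rw [← hη2, ← Real.le_log_iff_exp_le hη]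
    rw [one_div, Real.log_inv] at hLx
    linarith
  have hoffset : 16 / f θ * h ≤ |x| * h - η := by
    have : 0 ≤ h * (|x| - 16 / f θ - h) := mul_nonneg h0.le (by linarith)
    rw [hη2]; linarith
  have hstate : x₀ η + k * η / q = x₀ η + x * h := by
    rw [hx, hη2]; ring
  have hdown : ((k : ℝ) + p - q) * h / q = x - (1 - p / q) * h := by
    rw [hx]; field_simp; ring
  have hup : ((k : ℝ) + p) * h / q = x + p / q * h := by
    rw [hx]; ring
  rw [hstate, hdown, hup]
  rcases le_total 0 x with hpos | hneg
  · rw [abs_of_nonneg hpos] at hx1 hexp hoffset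
    have hmon : F (θ + 16 / f θ * h) ≤ F (x₀ η + x * h) := hmono (by linarith)
    exact gtil_drift_of_bias hx1 h0 hh1 hτ0 hτ1 (hF0 _) (hF1 _) (by linarith) hexp
  · rw [abs_of_nonpos hneg] at hx1 hexp hoffset
    have hmon : F (x₀ η + x * h) ≤ F (θ - 16 / f θ * h) := hmono (by linarith)
    have key := gtil_drift_of_bias (t := 1 - p / q) (P := 1 - F (x₀ η + x * h)) hx1 h0 hh1
      (by linarith) (by linarith) (by linarith [hF1 (x₀ η + x * h)])
      (by linarith [hF0 (x₀ η + x * h)]) (by linarith) hexp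
    rw [gtil_neg, ftil_neg, ← gtil_neg (-x - _), ← gtil_neg (-x + _)] at key
    convert key using 1
    ring_nf
end
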